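/- Let (Ω,d) be a minimally nice metric space and let γ be a rectifiable curve in (Ω,d). Then γ admits a quasihyperbolic parametrization g : [0,r] → Ω with the same image as γ, i.e. ℓ_k(g|_{[0,t]}) = t for all t ∈ [0,r] where r = ℓ_k(γ) is the quasihyperbolic length of γ, and g satisfies the Lipschitz condition d(g(s),g(t)) ≤ M·|s − t| for all s,t ∈ [0,r], where M = max{δ_Ω(x) : x in the image of γ}. -/

import Mathlib

open Set Filter Metric Topology UniformConvergence ENNReal

noncomputable section

variable {Ω : Type*} [MetricSpace Ω]

/-- The metric boundary `∂_dΩ` of a metric space `Ω`: the complement of (the image of) `Ω`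
in its metric completion `Ω̄^d`. -/
def metricBoundary (Ω : Type*) [MetricSpace Ω] : Set (UniformSpace.Completion Ω) :=
  (Set.range ((↑) : Ω → UniformSpace.Completion Ω))ᶜ

/-- `δ_Ω(z)`: the distance from `z ∈ Ω` to the metric boundary `∂_dΩ`. -/
def deltaOmega (z : Ω) : ℝ :=
  Metric.infDist ((z : UniformSpace.Completion Ω)) (metricBoundary Ω)

/-- A rectifiable curve in `Ω`, defined on `[a,b]`, joining `x` to `y`. -/
def IsCurveIn (γ : ℝ → Ω) (a b : ℝ) (x y : Ω) : Prop :=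
  a ≤ b ∧ ContinuousOn γ (Set.Icc a b) ∧ γ a = x ∧ γ b = y ∧
    eVariationOn γ (Set.Icc a b) ≠ ⊤

/-- The `d`-arclength function `t ↦ ℓ_d(γ|_{[a,t]})` of a curve `γ` on `[a,b]` (clamped). -/
def arcLengthFun (γ : ℝ → Ω) (a b : ℝ) : ℝ → ℝ :=
  fun t => (eVariationOn γ (Set.Icc a (max a (min t b)))).toReal

theorem arcLengthFun_monotone {γ : ℝ → Ω} {a b : ℝ} (hab : a ≤ b)
    (hrect : eVariationOn γ (Set.Icc a b) ≠ ⊤) : Monotone (arcLengthFun γ a b) := by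
  intro s t hst
  apply ENNReal.toReal_mono
  · exact ne_top_of_le_ne_top hrect
      (eVariationOn.mono γ (Set.Icc_subset_Icc_right (max_le hab (min_le_right _ _))))
  · exact eVariationOn.mono γ (Set.Icc_subset_Icc_right
      (max_le_max le_rfl (min_le_min hst le_rfl)))

/-- The quasihyperbolic length `ℓ_k(γ) = ∫_γ |dz| / δ_Ω(z)` of a rectifiable curve
`γ : [a,b] → Ω`: the Lebesgue–Stieltjes integral of `1/δ_Ω(γ(t))` with respect to the
arclength function of `γ`.  (Non-rectifiable "curves" get length `⊤`.) -/
def qhLength (γ : ℝ → Ω) (a b : ℝ) : ℝ≥0∞ :=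
  if h : a ≤ b ∧ eVariationOn γ (Set.Icc a b) ≠ ⊤ then
    ∫⁻ t in Set.Icc a b, ENNReal.ofReal (1 / deltaOmega (γ t))
      ∂(arcLengthFun_monotone h.1 h.2).stieltjesFunction.measure
  else ⊤

/-- The quasihyperbolic distance (as an extended real): the infimum of the quasihyperbolic
lengths of rectifiable curves in `Ω` joining `x` to `y`. -/
def qhEDist (x y : Ω) : ℝ≥0∞ :=
  ⨅ (γ : ℝ → Ω) (a : ℝ) (b : ℝ) (_ : IsCurveIn γ a b x y), qhLength γ a b

/-- The quasihyperbolic metric `k_Ω`. -/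
def qhDist (x y : Ω) : ℝ :=
  (qhEDist x y).toReal

/-- The inner (length) metric `λ_Ω` associated to `(Ω,d)`, as an extended real. -/
def innerEDist (x y : Ω) : ℝ≥0∞ :=
  ⨅ (γ : ℝ → Ω) (a : ℝ) (b : ℝ) (_ : IsCurveIn γ a b x y), eVariationOn γ (Set.Icc a b)

/-- `(Ω,d)` is minimally nice: rectifiably connected, locally compact, non-complete, and the
identity map from `(Ω,d)` to `(Ω,λ_Ω)` is continuous. -/
structure MinimallyNice (Ω : Type*) [MetricSpace Ω] : Prop where
  rectifiablyConnected : ∀ x y : Ω, ∃ (γ : ℝ → Ω) (a b : ℝ), IsCurveIn γ a b x y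
  locallyCompact : LocallyCompactSpace Ω
  nonComplete : ¬ CompleteSpace Ω
  idContinuous : ∀ x : Ω, Filter.Tendsto (fun y => innerEDist x y) (nhds x) (nhds 0)

/-- `γ` is a geodesic of the quasihyperbolic metric on the parameter set `s`
(parametrized by `k_Ω`-arclength). -/
def IsQHGeodesicOn (γ : ℝ → Ω) (s : Set ℝ) : Prop :=
  ∀ ⦃u⦄, u ∈ s → ∀ ⦃v⦄, v ∈ s → qhDist (γ u) (γ v) = |u - v|

/-- A quasihyperbolic geodesic segment from `x` to `y`. -/
def IsQHGeodesicSeg (γ : ℝ → Ω) (a b : ℝ) (x y : Ω) : Prop :=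
  a ≤ b ∧ γ a = x ∧ γ b = y ∧ IsQHGeodesicOn γ (Set.Icc a b)

/-- A quasihyperbolic geodesic ray `γ : [0,∞) → (Ω, k_Ω)`. -/
def IsQHGeodesicRay (γ : ℝ → Ω) : Prop :=
  IsQHGeodesicOn γ (Set.Ici 0)

/-- A quasihyperbolic geodesic line `γ : (-∞,∞) → (Ω, k_Ω)`. -/
def IsQHGeodesicLine (γ : ℝ → Ω) : Prop :=
  IsQHGeodesicOn γ Set.univ

/-- `(Ω,d)` is quasihyperbolically visible: for every pair of distinct points `p,q` of the
metric boundary there is a compact set `K ⊆ Ω` such that for all sequences `xₙ → p`, `yₙ → q`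
(in the metric `d`), every quasihyperbolic geodesic joining `xₙ` and `yₙ` meets `K`. -/
def QHVisible (Ω : Type*) [MetricSpace Ω] : Prop :=
  ∀ p q : UniformSpace.Completion Ω, p ∈ metricBoundary Ω → q ∈ metricBoundary Ω → p ≠ q →
    ∃ K : Set Ω, IsCompact K ∧
      ∀ x y : ℕ → Ω,
        Filter.Tendsto (fun n => ((x n : Ω) : UniformSpace.Completion Ω))
          Filter.atTop (nhds p) →
        Filter.Tendsto (fun n => ((y n : Ω) : UniformSpace.Completion Ω))
          Filter.atTop (nhds q) →
        ∀ (n : ℕ) (γ : ℝ → Ω) (a b : ℝ), IsQHGeodesicSeg γ a b (x n) (y n) →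
          ∃ t ∈ Set.Icc a b, γ t ∈ K

/-- `(Ω, k_Ω)` is Gromov hyperbolic: there is `δ ≥ 0` such that every quasihyperbolic
geodesic triangle is `δ`-thin. -/
def QHGromovHyperbolic (Ω : Type*) [MetricSpace Ω] : Prop :=
  ∃ δ : ℝ, 0 ≤ δ ∧
    ∀ (x y z : Ω) (γ₁ γ₂ γ₃ : ℝ → Ω) (a₁ b₁ a₂ b₂ a₃ b₃ : ℝ),
      IsQHGeodesicSeg γ₁ a₁ b₁ x y → IsQHGeodesicSeg γ₂ a₂ b₂ y z →
      IsQHGeodesicSeg γ₃ a₃ b₃ x z →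
      ∀ t ∈ Set.Icc a₁ b₁,
        ∃ u, (u ∈ Set.Icc a₂ b₂ ∧ qhDist (γ₁ t) (γ₂ u) ≤ δ) ∨
             (u ∈ Set.Icc a₃ b₃ ∧ qhDist (γ₁ t) (γ₃ u) ≤ δ)

/-- `(Ω,d)` is quasiconvex: some `A ≥ 1` so that every two points are joined by a curve of
`d`-length at most `A·d(x,y)`. -/
def QuasiconvexSpace (Ω : Type*) [MetricSpace Ω] : Prop :=
  ∃ A : ℝ, 1 ≤ A ∧ ∀ x y : Ω, ∃ (γ : ℝ → Ω) (a b : ℝ), IsCurveIn γ a b x y ∧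
    eVariationOn γ (Set.Icc a b) ≤ ENNReal.ofReal (A * dist x y)

/-- The Gehring–Hayman theorem holds in `(Ω,d)`: quasihyperbolic geodesics are essentially
the shortest curves, up to a multiplicative constant `C ≥ 1`. -/
def GehringHayman (Ω : Type*) [MetricSpace Ω] : Prop :=
  ∃ C : ℝ, 1 ≤ C ∧ ∀ x y : Ω, ∀ (γ : ℝ → Ω) (a b : ℝ), IsQHGeodesicSeg γ a b x y →
    ∀ (σ : ℝ → Ω) (a' b' : ℝ), IsCurveIn σ a' b' x y →
      eVariationOn γ (Set.Icc a b) ≤ ENNReal.ofReal C * eVariationOn σ (Set.Icc a' b')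
open MeasureTheory

theorem qh_var_add (γ : ℝ → Ω) {a s t : ℝ} (h1 : a ≤ s) (h2 : s ≤ t) :
    eVariationOn γ (Icc a t) = eVariationOn γ (Icc a s) + eVariationOn γ (Icc s t) := by
  have := eVariationOn.Icc_add_Icc γ (s := univ) h1 h2 (mem_univ _)
  simpa using this.symm

theorem qh_var_ne_top {γ : ℝ → Ω} {a b s t : ℝ}
    (hrect : eVariationOn γ (Icc a b) ≠ ⊤) (h1 : a ≤ s) (h2 : t ≤ b) :
    eVariationOn γ (Icc s t) ≠ ⊤ :=
  ne_top_of_le_ne_top hrect (eVariationOn.mono γ (Icc_subset_Icc h1 h2))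

theorem qh_len_cont {γ : ℝ → Ω} {a b : ℝ} (hcont : ContinuousOn γ (Icc a b))
    (hrect : eVariationOn γ (Icc a b) ≠ ⊤) :
    ContinuousOn (fun t => (eVariationOn γ (Icc a t)).toReal) (Icc a b) := by
  intro x hx
  have hl : Tendsto (fun y ↦ eVariationOn γ (Icc a b ∩ Icc y x)) (𝓝[Icc a b] x) (𝓝 0) :=
    BoundedVariationOn.tendsto_eVariationOn_Icc_zero_left hrect
      ((hcont x hx).mono inter_subset_left)
  have hr : Tendsto (fun y ↦ eVariationOn γ (Icc a b ∩ Icc x y)) (𝓝[Icc a b] x) (𝓝 0) :=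
    BoundedVariationOn.tendsto_eVariationOn_Icc_zero_right hrect x
      ((hcont x hx).mono inter_subset_left)
  have hl' := (ENNReal.tendsto_toReal ENNReal.zero_ne_top).comp hl
  have hr' := (ENNReal.tendsto_toReal ENNReal.zero_ne_top).comp hr
  have hs := hl'.add hr'
  simp only [ENNReal.toReal_zero, add_zero] at hs
  rw [ContinuousWithinAt, tendsto_iff_dist_tendsto_zero]
  refine squeeze_zero' (Eventually.of_forall fun _ => dist_nonneg) ?_ hs
  filter_upwards [self_mem_nhdsWithin] with y hy
  simp only [Function.comp]
  rcases le_total x y with h | h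
  · rw [qh_var_add γ hx.1 h, ENNReal.toReal_add (qh_var_ne_top hrect le_rfl hx.2)
      (qh_var_ne_top hrect hx.1 hy.2), Real.dist_eq, add_sub_cancel_left,
      abs_of_nonneg ENNReal.toReal_nonneg,
      inter_eq_self_of_subset_right (Icc_subset_Icc hx.1 hy.2)]
    exact le_add_of_nonneg_left ENNReal.toReal_nonneg
  · rw [qh_var_add γ hy.1 h, ENNReal.toReal_add (qh_var_ne_top hrect le_rfl hy.2)
      (qh_var_ne_top hrect hy.1 hx.2), Real.dist_eq, sub_add_cancel_left, abs_neg,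
      abs_of_nonneg ENNReal.toReal_nonneg,
      inter_eq_self_of_subset_right (Icc_subset_Icc hy.1 hx.2)]
    exact le_add_of_nonneg_right ENNReal.toReal_nonneg

theorem qh_arc_cont {γ : ℝ → Ω} {a b : ℝ} (hab : a ≤ b) (hcont : ContinuousOn γ (Icc a b))
    (hrect : eVariationOn γ (Icc a b) ≠ ⊤) : Continuous (arcLengthFun γ a b) := by
  have : arcLengthFun γ a b = (fun t => (eVariationOn γ (Icc a t)).toReal) ∘
    (fun t => max a (min t b)) := rfl
  rw [this]
  exact (qh_len_cont hcont hrect).comp_continuous (by fun_prop)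
    (fun t => ⟨le_max_left _ _, max_le hab (min_le_right _ _)⟩)

theorem qh_meas {γ : ℝ → Ω} {a b : ℝ} (hab : a ≤ b) (hcont : ContinuousOn γ (Icc a b))
    (hrect : eVariationOn γ (Icc a b) ≠ ⊤) (v : ℝ) (hv : v ∈ Icc a b) :
    (arcLengthFun_monotone hab hrect).stieltjesFunction.measure (Icc a v)
      = eVariationOn γ (Icc a v) := by
  have hc := qh_arc_cont hab hcont hrect
  have hS : ((arcLengthFun_monotone hab hrect).stieltjesFunction : ℝ → ℝ)
      = arcLengthFun γ a b := by
    funext x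
    rw [Monotone.stieltjesFunction_eq]
    exact hc.continuousWithinAt.rightLim_eq
  rw [StieltjesFunction.measure_Icc, hS, hc.continuousWithinAt.leftLim_eq]
  simp only [arcLengthFun, min_eq_left hv.2, max_eq_right hv.1, min_eq_left hab, max_self]
  rw [eVariationOn.subsingleton γ (s := Icc a a) (by simp)]
  simp [ENNReal.ofReal_toReal (qh_var_ne_top hrect le_rfl hv.2)]

theorem qh_lenEq {γ : ℝ → Ω} {a b : ℝ} (hab : a ≤ b) (hcont : ContinuousOn γ (Icc a b))
    (hrect : eVariationOn γ (Icc a b) ≠ ⊤) (ν : Measure ℝ)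
    (hν : ∀ v ∈ Icc a b, ν (Icc a v) = eVariationOn γ (Icc a v)) :
    qhLength γ a b = ∫⁻ t in Icc a b, ENNReal.ofReal (1 / deltaOmega (γ t)) ∂ν := by
  rw [qhLength, dif_pos ⟨hab, hrect⟩]
  have hμ := qh_meas hab hcont hrect
  set μ := (arcLengthFun_monotone hab hrect).stieltjesFunction.measure with hμdef
  have hfin : IsFiniteMeasure (μ.restrict (Icc a b)) := by
    constructor
    rw [Measure.restrict_apply_univ, hμ b ⟨hab, le_rfl⟩]
    exact hrect.lt_top
  have : μ.restrict (Icc a b) = ν.restrict (Icc a b) := by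
    apply Measure.ext_of_Iic
    intro x
    rw [Measure.restrict_apply measurableSet_Iic, Measure.restrict_apply measurableSet_Iic]
    by_cases hx : a ≤ x
    · have : Iic x ∩ Icc a b = Icc a (min x b) := by
        ext y; simp; tauto
      rw [this, hμ _ ⟨le_min hx hab, min_le_right _ _⟩, hν _ ⟨le_min hx hab, min_le_right _ _⟩]
    · have : Iic x ∩ Icc a b = ∅ := by
        ext y; simp; intro h1 h2; linarith
      simp [this]
  rw [this]

theorem qh_delta_cont : Continuous (deltaOmega : Ω → ℝ) := by
  unfold deltaOmega
  exact (Metric.continuous_infDist_pt _).comp (UniformSpace.Completion.continuous_coe Ω)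

theorem qh_delta_pos (h : MinimallyNice Ω) (x : Ω) : 0 < deltaOmega x := by
  have := h.locallyCompact
  have hne : (metricBoundary Ω).Nonempty := by
    by_contra hh
    rw [Set.not_nonempty_iff_eq_empty, metricBoundary, Set.compl_empty_iff] at hh
    apply h.nonComplete
    have hi : IsUniformInducing ((↑) : Ω → UniformSpace.Completion Ω) :=
      UniformSpace.Completion.isUniformInducing_coe Ω
    rw [completeSpace_iff_isComplete_range hi, hh]
    exact isComplete_univ
  have hop : IsOpen (Set.range ((↑) : Ω → UniformSpace.Completion Ω)) := by
    rw [Metric.isOpen_iff]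
    rintro _ ⟨y, rfl⟩
    obtain ⟨ρ, hρ, hK⟩ := Metric.exists_isCompact_closedBall y
    refine ⟨ρ, hρ, ?_⟩
    have h1 : Metric.ball (y : UniformSpace.Completion Ω) ρ ⊆
        closure (Metric.ball (y : UniformSpace.Completion Ω) ρ ∩
          Set.range ((↑) : Ω → UniformSpace.Completion Ω)) :=
      Dense.open_subset_closure_inter UniformSpace.Completion.denseRange_coe Metric.isOpen_ball
    have h2 : IsClosed (((↑) : Ω → UniformSpace.Completion Ω) '' Metric.closedBall y ρ) :=
      (hK.image (UniformSpace.Completion.continuous_coe Ω)).isClosed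
    have h3 : Metric.ball (y : UniformSpace.Completion Ω) ρ ∩
          Set.range ((↑) : Ω → UniformSpace.Completion Ω) ⊆
        ((↑) : Ω → UniformSpace.Completion Ω) '' Metric.closedBall y ρ := by
      rintro _ ⟨hz, z, rfl⟩
      refine ⟨z, ?_, rfl⟩
      rw [Metric.mem_ball, UniformSpace.Completion.dist_eq] at hz
      exact hz.le
    exact (h1.trans (closure_minimal h3 h2)).trans (Set.image_subset_range _ _)
  have hcl : IsClosed (metricBoundary Ω) := hop.isClosed_compl
  exact (hcl.notMem_iff_infDist_pos hne).1 (by simp [metricBoundary])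

theorem qh_ioc {γ : ℝ → Ω} {a b : ℝ} (hrect : eVariationOn γ (Icc a b) ≠ ⊤) (μ : Measure ℝ)
    (hμ : ∀ v ∈ Icc a b, μ (Icc a v) = eVariationOn γ (Icc a v)) {s t : ℝ}
    (h1 : a ≤ s) (h2 : s ≤ t) (h3 : t ≤ b) : μ (Ioc s t) = eVariationOn γ (Icc s t) := by
  have hu : Icc a t = Icc a s ∪ Ioc s t := (Icc_union_Ioc_eq_Icc h1 h2).symm
  have hd : Disjoint (Icc a s) (Ioc s t) := by
    rw [Set.disjoint_left]; intro x hx hx'; exact absurd hx.2 (not_le.2 hx'.1)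
  have := hμ t ⟨h1.trans h2, h3⟩
  rw [hu, measure_union hd measurableSet_Ioc, hμ s ⟨h1, h2.trans h3⟩, ← hu,
    qh_var_add γ h1 h2] at this
  exact (ENNReal.add_right_inj (qh_var_ne_top hrect le_rfl (h2.trans h3))).1 this

theorem qh_reparam {γ g : ℝ → Ω} {a b : ℝ}
    (hrect : eVariationOn γ (Icc a b) ≠ ⊤) (μ : Measure ℝ)
    (hμ : ∀ v ∈ Icc a b, μ (Icc a v) = eVariationOn γ (Icc a v))
    (q : ℝ → ℝ) (hqm : Monotone q) (hqc : ContinuousOn q (Icc a b)) (hqa : q a = 0)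
    (hg : Continuous g) (hgq : ∀ s ∈ Icc a b, g (q s) = γ s) {s : ℝ} (hs : s ∈ Icc a b) :
    qhLength g 0 (q s) = ∫⁻ t in Icc a s, ENNReal.ofReal (1 / deltaOmega (γ t)) ∂μ := by
  have hvar : ∀ u ∈ Icc a b, eVariationOn g (Icc 0 (q u)) = eVariationOn γ (Icc a u) := by
    intro u hu
    have himg : q '' Icc a u = Icc 0 (q u) := by
      apply Subset.antisymm
      · rintro _ ⟨x, hx, rfl⟩
        exact ⟨hqa ▸ hqm hx.1, hqm hx.2⟩
      · rw [← hqa]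
        exact intermediate_value_Icc hu.1 (hqc.mono (Icc_subset_Icc_right hu.2))
    rw [← himg, ← eVariationOn.comp_eq_of_monotoneOn g q (hqm.monotoneOn _)]
    apply eVariationOn.congr
    intro x hx
    exact hgq x ⟨hx.1, hx.2.trans hu.2⟩
  have hq0 : 0 ≤ q s := hqa ▸ hqm hs.1
  have hw : Measurable (fun t => ENNReal.ofReal (1 / deltaOmega (g t))) := by
    apply ENNReal.measurable_ofReal.comp
    exact measurable_const.div (qh_delta_cont.comp hg).measurable
  rw [qh_lenEq hq0 hg.continuousOn (by
      rw [hvar s hs]; exact qh_var_ne_top hrect le_rfl hs.2)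
    ((μ.restrict (Icc a s)).map q)]
  · rw [setLIntegral_map measurableSet_Icc hw hqm.measurable,
      Measure.restrict_restrict (hqm.measurable measurableSet_Icc)]
    have : q ⁻¹' Icc 0 (q s) ∩ Icc a s = Icc a s := by
      apply inter_eq_self_of_subset_right
      intro x hx
      exact ⟨hqa ▸ hqm hx.1, hqm hx.2⟩
    rw [this]
    apply setLIntegral_congr_fun measurableSet_Icc
    intro x hx
    simp only [hgq x ⟨hx.1, hx.2.trans hs.2⟩]
  · intro v hv
    rw [Measure.map_apply hqm.measurable measurableSet_Icc,
      Measure.restrict_apply (hqm.measurable measurableSet_Icc)]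
    have hqc' : ContinuousOn q (Icc a s) := hqc.mono (Icc_subset_Icc_right hs.2)
    have hcomp : IsCompact (Icc a s ∩ q ⁻¹' {v}) :=
      isCompact_Icc.of_isClosed_subset
        (hqc'.preimage_isClosed_of_isClosed isClosed_Icc isClosed_singleton) inter_subset_left
    have hne : (Icc a s ∩ q ⁻¹' {v}).Nonempty := by
      have := intermediate_value_Icc hs.1 hqc'
      rw [hqa] at this
      obtain ⟨u, hu, rfl⟩ := this hv
      exact ⟨u, hu, rfl⟩
    obtain ⟨u, ⟨hu, huv⟩, hmax⟩ := hcomp.exists_isGreatest hne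
    have huv : q u = v := huv
    have hub : u ∈ Icc a b := ⟨hu.1, hu.2.trans hs.2⟩
    have : q ⁻¹' Icc 0 v ∩ Icc a s = Icc a u := by
      ext x
      constructor
      · rintro ⟨hx1, hx2⟩
        refine ⟨hx2.1, ?_⟩
        by_contra hlt
        push Not at hlt
        have hx3 : q x = v := le_antisymm hx1.2 (huv ▸ hqm hlt.le)
        exact absurd (hmax ⟨hx2, hx3⟩) (not_le.2 hlt)
      · intro hx
        exact ⟨⟨hqa ▸ hqm hx.1, huv ▸ hqm hx.2⟩, hx.1, hx.2.trans hu.2⟩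
    rw [this, hμ u hub, ← huv, hvar u hub]

theorem qh_param {γ : ℝ → Ω} {a b M : ℝ} (hab : a ≤ b) (hM : 0 ≤ M) (q : ℝ → ℝ)
    (hqm : Monotone q) (hqc : ContinuousOn q (Icc a b)) (hqa : q a = 0)
    (hd : ∀ s ∈ Icc a b, ∀ t ∈ Icc a b, s ≤ t → dist (γ s) (γ t) ≤ M * (q t - q s)) :
    ∃ g : ℝ → Ω, Continuous g ∧ (∀ s ∈ Icc a b, g (q s) = γ s) ∧
      ∀ s t, dist (g s) (g t) ≤ M * |s - t| := by
  have h0 : 0 ≤ q b := hqa ▸ hqm hab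
  have hd' : ∀ s ∈ Icc a b, ∀ t ∈ Icc a b, dist (γ s) (γ t) ≤ M * |q s - q t| := by
    intro s hs t ht
    rcases le_total s t with h | h
    · rw [abs_sub_comm, abs_of_nonneg (sub_nonneg.2 (hqm h))]; exact hd s hs t ht h
    · rw [dist_comm, abs_of_nonneg (sub_nonneg.2 (hqm h))]; exact hd t ht s hs h
  have hex : ∀ τ : ℝ, ∃ u ∈ Icc a b, q u = max 0 (min τ (q b)) := by
    intro τ
    have := intermediate_value_Icc hab hqc
    rw [hqa] at this
    exact this ⟨le_max_left _ _, max_le h0 (min_le_right _ _)⟩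
  choose φ hφ hqφ using hex
  have hlip : ∀ s t, dist (γ (φ s)) (γ (φ t)) ≤ M * |s - t| := by
    intro s t
    refine (hd' _ (hφ s) _ (hφ t)).trans (mul_le_mul_of_nonneg_left ?_ hM)
    rw [hqφ, hqφ]
    rw [max_comm 0, max_comm 0]
    refine (abs_max_sub_max_le_abs _ _ _).trans ((abs_min_sub_min_le_max _ _ _ _).trans ?_)
    simp
  refine ⟨fun τ => γ (φ τ), ?_, ?_, hlip⟩
  · refine (LipschitzWith.of_dist_le_mul (K := ⟨M, hM⟩) ?_).continuous
    intro s t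
    rw [Real.dist_eq]
    exact hlip s t
  · intro s hs
    have h1 : q (φ (q s)) = q s := by
      rw [hqφ, min_eq_left (hqm hs.2), max_eq_right (hqa ▸ hqm hs.1)]
    have := hd' _ (hφ (q s)) s hs
    rw [h1, sub_self, abs_zero, mul_zero] at this
    exact dist_le_zero.1 this

/-- **Remark 5.1 (quasihyperbolic parametrization).**  In a minimally nice space, every
rectifiable curve `γ : [a,b] → Ω` admits a quasihyperbolic parametrization
`g : [0,r] → Ω`, `r = ℓ_k(γ)`, with the same image, satisfying `ℓ_k(g|_{[0,t]}) = t` for all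
`t ∈ [0,r]` and the Lipschitz condition `d(g(s),g(t)) ≤ M·|s-t|` with
`M = max{δ_Ω(x) : x ∈ γ([a,b])}`. -/
theorem exists_quasihyperbolic_parametrization
    {Ω : Type*} [MetricSpace Ω]
    (hnice : MinimallyNice Ω)
    (γ : ℝ → Ω) (a b : ℝ) (hab : a ≤ b)
    (hcont : ContinuousOn γ (Set.Icc a b))
    (hrect : eVariationOn γ (Set.Icc a b) ≠ ⊤) :
    ∃ (r : ℝ) (g : ℝ → Ω),
      0 ≤ r ∧
      ENNReal.ofReal r = qhLength γ a b ∧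
      g '' Set.Icc 0 r = γ '' Set.Icc a b ∧
      (∀ t ∈ Set.Icc 0 r, qhLength g 0 t = ENNReal.ofReal t) ∧
      (∀ s ∈ Set.Icc 0 r, ∀ t ∈ Set.Icc 0 r,
        dist (g s) (g t) ≤ sSup (deltaOmega '' (γ '' Set.Icc a b)) * |s - t|) := by
  classical
  set M := sSup (deltaOmega '' (γ '' Set.Icc a b)) with hMdef
  have hpos := qh_delta_pos hnice
  have hδγ : ContinuousOn (fun t => deltaOmega (γ t)) (Icc a b) :=
    qh_delta_cont.comp_continuousOn hcont
  have hbdd : BddAbove (deltaOmega '' (γ '' Set.Icc a b)) :=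
    ((isCompact_Icc.image_of_continuousOn hcont).image qh_delta_cont).bddAbove
  have hM : ∀ t ∈ Icc a b, deltaOmega (γ t) ≤ M := fun t ht =>
    le_csSup hbdd ⟨γ t, ⟨t, ht, rfl⟩, rfl⟩
  have hMpos : 0 < M := (hpos _).trans_le (hM a ⟨le_rfl, hab⟩)
  obtain ⟨W, hW⟩ : ∃ W : ℝ, ∀ t ∈ Icc a b, 1 / deltaOmega (γ t) ≤ W := by
    have hc : ContinuousOn (fun t => 1 / deltaOmega (γ t)) (Icc a b) :=
      continuousOn_const.div hδγ (fun t _ => (hpos _).ne')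
    obtain ⟨W, hW⟩ := (isCompact_Icc.image_of_continuousOn hc).bddAbove
    exact ⟨W, fun t ht => hW ⟨t, ht, rfl⟩⟩
  have hWpos : 0 < W := (one_div_pos.2 (hpos _)).trans_le (hW a ⟨le_rfl, hab⟩)
  have hμ := qh_meas hab hcont hrect
  set μ := (arcLengthFun_monotone hab hrect).stieltjesFunction.measure with hμdef
  set w : ℝ → ℝ≥0∞ := fun t => ENNReal.ofReal (1 / deltaOmega (γ t)) with hw
  set F : ℝ → ℝ≥0∞ := fun s => ∫⁻ t in Icc a s, w t ∂μ with hF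
  have hFadd : ∀ s ∈ Icc a b, ∀ t ∈ Icc a b, s ≤ t → F t = F s + ∫⁻ x in Ioc s t, w x ∂μ := by
    intro s hs t ht hst
    have hd : Disjoint (Icc a s) (Ioc s t) := by
      rw [Set.disjoint_left]; intro x hx hx'; exact absurd hx.2 (not_le.2 hx'.1)
    simp only [hF]
    rw [← lintegral_union measurableSet_Ioc hd, Icc_union_Ioc_eq_Icc hs.1 hst]
  have hup : ∀ s ∈ Icc a b, ∀ t ∈ Icc a b, s ≤ t →
      ∫⁻ x in Ioc s t, w x ∂μ ≤ ENNReal.ofReal W * eVariationOn γ (Icc s t) := by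
    intro s hs t ht hst
    rw [← qh_ioc hrect μ hμ hs.1 hst ht.2, ← setLIntegral_const]
    exact setLIntegral_mono' measurableSet_Ioc fun x hx =>
      ENNReal.ofReal_le_ofReal (hW x ⟨hs.1.trans hx.1.le, hx.2.trans ht.2⟩)
  have hlow : ∀ s ∈ Icc a b, ∀ t ∈ Icc a b, s ≤ t →
      ENNReal.ofReal (1 / M) * eVariationOn γ (Icc s t) ≤ ∫⁻ x in Ioc s t, w x ∂μ := by
    intro s hs t ht hst
    rw [← qh_ioc hrect μ hμ hs.1 hst ht.2, ← setLIntegral_const]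
    exact setLIntegral_mono' measurableSet_Ioc fun x hx =>
      ENNReal.ofReal_le_ofReal (one_div_le_one_div_of_le (hpos _)
        (hM x ⟨hs.1.trans hx.1.le, hx.2.trans ht.2⟩))
  have hIfin : ∀ s ∈ Icc a b, ∀ t ∈ Icc a b, s ≤ t → ∫⁻ x in Ioc s t, w x ∂μ ≠ ⊤ := by
    intro s hs t ht hst
    exact ne_top_of_le_ne_top (ENNReal.mul_ne_top ENNReal.ofReal_ne_top
      (qh_var_ne_top hrect hs.1 ht.2)) (hup s hs t ht hst)
  have haa : a ∈ Icc a b := ⟨le_rfl, hab⟩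
  have hbb : b ∈ Icc a b := ⟨hab, le_rfl⟩
  have hFa : F a = 0 := by
    have : μ (Icc a a) = 0 := by
      rw [hμ a haa, eVariationOn.subsingleton γ (s := Icc a a) (by simp)]
    exact setLIntegral_measure_zero _ _ this
  have hFfin : ∀ s ∈ Icc a b, F s ≠ ⊤ := by
    intro s hs
    rw [hFadd a haa s hs hs.1, hFa, zero_add]
    exact hIfin a haa s hs hs.1
  have hsub : ∀ s ∈ Icc a b, ∀ t ∈ Icc a b, s ≤ t →
      (F t).toReal - (F s).toReal = (∫⁻ x in Ioc s t, w x ∂μ).toReal := by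
    intro s hs t ht hst
    rw [hFadd s hs t ht hst, ENNReal.toReal_add (hFfin s hs) (hIfin s hs t ht hst)]
    ring
  set q : ℝ → ℝ := fun t => (F (max a (min t b))).toReal with hq
  have hcl : ∀ t, max a (min t b) ∈ Icc a b := fun t =>
    ⟨le_max_left _ _, max_le hab (min_le_right _ _)⟩
  have hqF : ∀ t ∈ Icc a b, q t = (F t).toReal := by
    intro t ht
    simp only [hq, min_eq_left ht.2, max_eq_right ht.1]
  have hqm : Monotone q := by
    intro s t hst
    have hle : max a (min s b) ≤ max a (min t b) := max_le_max le_rfl (min_le_min hst le_rfl)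
    have := hsub _ (hcl s) _ (hcl t) hle
    have h2 : 0 ≤ (∫⁻ x in Ioc (max a (min s b)) (max a (min t b)), w x ∂μ).toReal :=
      ENNReal.toReal_nonneg
    simp only [hq]
    linarith
  have hqa : q a = 0 := by rw [hqF a haa, hFa]; rfl
  have hlen := qh_len_cont hcont hrect
  have hqup : ∀ s ∈ Icc a b, ∀ t ∈ Icc a b, s ≤ t → q t - q s ≤
      W * ((eVariationOn γ (Icc a t)).toReal - (eVariationOn γ (Icc a s)).toReal) := by
    intro s hs t ht hst
    rw [hqF t ht, hqF s hs, hsub s hs t ht hst, qh_var_add γ hs.1 hst,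
      ENNReal.toReal_add (qh_var_ne_top hrect le_rfl hs.2) (qh_var_ne_top hrect hs.1 ht.2),
      add_sub_cancel_left]
    have := ENNReal.toReal_mono (ENNReal.mul_ne_top ENNReal.ofReal_ne_top
      (qh_var_ne_top hrect hs.1 ht.2)) (hup s hs t ht hst)
    rwa [ENNReal.toReal_mul, ENNReal.toReal_ofReal hWpos.le] at this
  have hqc : ContinuousOn q (Icc a b) := by
    intro x hx
    have h1 := hlen x hx
    rw [ContinuousWithinAt, tendsto_iff_dist_tendsto_zero] at h1 ⊢
    have h2 := h1.const_mul W
    rw [mul_zero] at h2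
    refine squeeze_zero' (Eventually.of_forall fun _ => dist_nonneg) ?_ h2
    filter_upwards [self_mem_nhdsWithin] with y hy
    simp only [Real.dist_eq]
    rcases le_total x y with h | h
    · rw [abs_of_nonneg (sub_nonneg.2 (hqm h))]
      exact (hqup x hx y hy h).trans (mul_le_mul_of_nonneg_left (le_abs_self _) hWpos.le)
    · rw [abs_sub_comm, abs_of_nonneg (sub_nonneg.2 (hqm h)), abs_sub_comm]
      exact (hqup y hy x hx h).trans (mul_le_mul_of_nonneg_left (le_abs_self _) hWpos.le)
  have hd : ∀ s ∈ Icc a b, ∀ t ∈ Icc a b, s ≤ t → dist (γ s) (γ t) ≤ M * (q t - q s) := by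
    intro s hs t ht hst
    rw [hqF t ht, hqF s hs, hsub s hs t ht hst]
    have h1 := ENNReal.toReal_mono (hIfin s hs t ht hst) (hlow s hs t ht hst)
    rw [ENNReal.toReal_mul, ENNReal.toReal_ofReal (one_div_pos.2 hMpos).le] at h1
    have h2 : dist (γ s) (γ t) ≤ (eVariationOn γ (Icc s t)).toReal :=
      BoundedVariationOn.dist_le (qh_var_ne_top hrect hs.1 ht.2) ⟨le_rfl, hst⟩ ⟨hst, le_rfl⟩
    refine h2.trans ?_
    rw [one_div, inv_mul_le_iff₀ hMpos] at h1
    exact h1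
  obtain ⟨g, hgc, hgq, hgl⟩ := qh_param hab hMpos.le q hqm hqc hqa hd
  have hq0 : 0 ≤ q b := hqa ▸ hqm hab
  have hsurj : Icc 0 (q b) ⊆ q '' Icc a b := by
    rw [← hqa]; exact intermediate_value_Icc hab hqc
  refine ⟨q b, g, hq0, ?_, ?_, ?_, fun s _ t _ => hgl s t⟩
  · rw [qh_lenEq hab hcont hrect μ hμ, hqF b hbb, ENNReal.ofReal_toReal (hFfin b hbb)]
  · apply Subset.antisymm
    · rintro _ ⟨τ, hτ, rfl⟩
      obtain ⟨u, hu, rfl⟩ := hsurj hτ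
      exact ⟨u, hu, (hgq u hu).symm⟩
    · rintro _ ⟨u, hu, rfl⟩
      exact ⟨q u, ⟨hqa ▸ hqm hu.1, hqm hu.2⟩, hgq u hu⟩
  · intro τ hτ
    obtain ⟨u, hu, rfl⟩ := hsurj hτ
    rw [qh_reparam hrect μ hμ q hqm hqc hqa hgc hgq hu, hqF u hu,
      ENNReal.ofReal_toReal (hFfin u hu)]
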